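/- Let p : ℕ → ℝ be a nonincreasing probability sequence with p 0 ≤ 2/3, let g : ℕ → ℝ satisfy g k ≥ 0 for all k and ∑' k, g k = 1, and let π : ℕ × ℕ × ℕ → ℕ be any bijection. Then the Bhattacharyya (fidelity) coefficient between the rearranged distribution and the product distribution satisfies ∑'_{(i,j,k)} √(p (π (i,j,k)) · p i · p j · g k) ≤ √(1 − (2/9)²). -/

import Mathlib

/-- Among finite sets of a given size, initial segments maximize the sum of an antitone
sequence. -/
theorem Antitone.sum_le_sum_range_card {p : ℕ → ℝ} (hp : Antitone p) (s : Finset ℕ) :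
    ∑ i ∈ s, p i ≤ ∑ i ∈ Finset.range s.card, p i := by
  induction s using Finset.induction_on_max with
  | empty => simp
  | insert a s hlt ih =>
    have ha : a ∉ s := fun h => lt_irrefl a (hlt a h)
    have hcard : s.card ≤ a := by
      simpa using Finset.card_le_card fun x hx => Finset.mem_range.2 (hlt x hx)
    rw [Finset.sum_insert ha, Finset.card_insert_of_notMem ha, Finset.sum_range_succ]
    linarith [hp hcard]

/-- A finite sum of a triple product is bounded by the product over the first two projections,
provided the third factor has finite sums at most one. -/
theorem sum_triple_le_sum_image_mul_sum_image {α β γ : Type*} [DecidableEq α] [DecidableEq β]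
    {f : α → ℝ} {f' : β → ℝ} {g : γ → ℝ} (hf : ∀ i, 0 ≤ f i) (hf' : ∀ j, 0 ≤ f' j)
    (hg : ∀ k, 0 ≤ g k) (hg1 : ∀ s : Finset γ, ∑ k ∈ s, g k ≤ 1) (s : Finset (α × β × γ)) :
    ∑ x ∈ s, f x.1 * f' x.2.1 * g x.2.2 ≤
      (∑ i ∈ s.image fun x => x.1, f i) * ∑ j ∈ s.image fun x => x.2.1, f' j := by
  classical
  set A := s.image fun x => x.1
  set B := s.image fun x => x.2.1
  set C := s.image fun x => x.2.2
  have hsub : s ⊆ A ×ˢ B ×ˢ C := fun x hx => by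
    simp only [Finset.mem_product]
    exact ⟨Finset.mem_image_of_mem _ hx, Finset.mem_image_of_mem _ hx,
      Finset.mem_image_of_mem _ hx⟩
  calc ∑ x ∈ s, f x.1 * f' x.2.1 * g x.2.2
      ≤ ∑ x ∈ A ×ˢ B ×ˢ C, f x.1 * f' x.2.1 * g x.2.2 :=
        Finset.sum_le_sum_of_subset_of_nonneg hsub fun x _ _ =>
          mul_nonneg (mul_nonneg (hf _) (hf' _)) (hg _)
    _ = ((∑ i ∈ A, f i) * ∑ j ∈ B, f' j) * ∑ k ∈ C, g k := by
        simp only [Finset.sum_product, mul_assoc, ← Finset.mul_sum, ← Finset.sum_mul]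
    _ ≤ (∑ i ∈ A, f i) * ∑ j ∈ B, f' j :=
        mul_le_of_le_one_right (mul_nonneg (Finset.sum_nonneg fun i _ => hf i)
          (Finset.sum_nonneg fun j _ => hf' j)) (hg1 C)

/-- The fidelity of two biased coins is at most `√(1 - d²)`, with `d` their distance. -/
theorem sqrt_mul_sqrt_add_le_sqrt_one_sub_sq {a b : ℝ} (ha : 0 ≤ a) (ha1 : a ≤ 1) (hb : 0 ≤ b)
    (hb1 : b ≤ 1) : √a * √b + √(1 - a) * √(1 - b) ≤ √(1 - (a - b) ^ 2) := by
  apply Real.le_sqrt_of_sq_le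
  have h1 := Real.sq_sqrt ha
  have h2 := Real.sq_sqrt hb
  have h3 := Real.sq_sqrt (sub_nonneg.2 ha1)
  have h4 := Real.sq_sqrt (sub_nonneg.2 hb1)
  have key := two_mul_le_add_sq (√a * √(1 - a)) (√b * √(1 - b))
  simp only [mul_pow, h1, h2, h3, h4] at key
  calc (√a * √b + √(1 - a) * √(1 - b)) ^ 2
      = √a ^ 2 * √b ^ 2 + √(1 - a) ^ 2 * √(1 - b) ^ 2
        + 2 * (√a * √(1 - a)) * (√b * √(1 - b)) := by ring
    _ ≤ 1 - (a - b) ^ 2 := by rw [h1, h2, h3, h4]; linarith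

/-- The fidelity of two (sub)distributions is bounded through the probabilities they give to a
finite event. -/
theorem tsum_sqrt_mul_le_sqrt_one_sub_sq {ι : Type*} {q r : ι → ℝ} (hq : ∀ i, 0 ≤ q i)
    (hr : ∀ i, 0 ≤ r i) (hq1 : ∀ s : Finset ι, ∑ i ∈ s, q i ≤ 1)
    (hr1 : ∀ s : Finset ι, ∑ i ∈ s, r i ≤ 1) (s : Finset ι) :
    ∑' i, √(q i * r i) ≤ √(1 - (∑ i ∈ s, q i - ∑ i ∈ s, r i) ^ 2) := by
  classical
  refine Real.tsum_le_of_sum_le (fun i => Real.sqrt_nonneg _) fun t => ?_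
  have hcs (u : Finset ι) : ∑ i ∈ u, √(q i * r i) ≤ √(∑ i ∈ u, q i) * √(∑ i ∈ u, r i) := by
    simpa only [Real.sqrt_mul (hq _)] using Real.sum_sqrt_mul_sqrt_le u hq hr
  have hin {h : ι → ℝ} (hh : ∀ i, 0 ≤ h i) : ∑ i ∈ t ∩ s, h i ≤ ∑ i ∈ s, h i :=
    Finset.sum_le_sum_of_subset_of_nonneg Finset.inter_subset_right fun i _ _ => hh i
  have hout {h : ι → ℝ} (h1 : ∀ u : Finset ι, ∑ i ∈ u, h i ≤ 1) :
      ∑ i ∈ t \ s, h i ≤ 1 - ∑ i ∈ s, h i := by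
    rw [le_sub_iff_add_le, ← Finset.sum_union Finset.sdiff_disjoint]
    exact h1 _
  calc ∑ i ∈ t, √(q i * r i)
      = ∑ i ∈ t ∩ s, √(q i * r i) + ∑ i ∈ t \ s, √(q i * r i) :=
        (Finset.sum_inter_add_sum_sdiff t s _).symm
    _ ≤ √(∑ i ∈ t ∩ s, q i) * √(∑ i ∈ t ∩ s, r i)
        + √(∑ i ∈ t \ s, q i) * √(∑ i ∈ t \ s, r i) := add_le_add (hcs _) (hcs _)
    _ ≤ √(∑ i ∈ s, q i) * √(∑ i ∈ s, r i)
        + √(1 - ∑ i ∈ s, q i) * √(1 - ∑ i ∈ s, r i) := by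
        gcongr ?_ * ?_ + ?_ * ?_ <;> apply Real.sqrt_le_sqrt
        exacts [hin hq, hin hr, hout hq1, hout hr1]
    _ ≤ _ := sqrt_mul_sqrt_add_le_sqrt_one_sub_sq (Finset.sum_nonneg fun i _ => hq i) (hq1 s)
        (Finset.sum_nonneg fun i _ => hr i) (hr1 s)

/-- A nonincreasing probability sequence with first term at most `2/3` has a partial sum in
`[1/3, 2/3]`. -/
theorem exists_sum_range_mem_Icc {p : ℕ → ℝ} (hp : Antitone p) (hp1 : HasSum p 1)
    (h0 : p 0 ≤ 2 / 3) : ∃ m, ∑ i ∈ Finset.range m, p i ∈ Set.Icc (1 / 3 : ℝ) (2 / 3) := by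
  by_cases h : 1 / 3 ≤ p 0
  · exact ⟨1, by rw [Finset.sum_range_one]; exact ⟨h, h0⟩⟩
  have hex : ∃ m, 1 / 3 ≤ ∑ i ∈ Finset.range m, p i :=
    (hp1.tendsto_sum_nat.eventually_const_le (by norm_num)).exists
  classical
  refine ⟨Nat.find hex, Nat.find_spec hex, ?_⟩
  cases hm : Nat.find hex with
  | zero => norm_num
  | succ n =>
    have hn := Nat.find_min hex (m := n) (by omega)
    rw [Finset.sum_range_succ]
    linarith [hp (Nat.zero_le n)]


/-- For a nonincreasing probability sequence `p` with `p 0 ≤ 2/3`, a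
nonnegative sequence `g` summing to 1, and any bijection `π : ℕ × ℕ × ℕ → ℕ`, the
Bhattacharyya (fidelity) coefficient between the rearranged distribution and the
product distribution `(i,j,k) ↦ p i * p j * g k` is at most `√(1 - (2/9)²)`. -/
theorem self_embezzlement_channel_fidelity_upper_bound
    (p : ℕ → ℝ)
    (hnonneg : ∀ k, 0 ≤ p (k + 1))
    (hmono : ∀ k, p (k + 1) ≤ p k)
    (hsum : Summable p)
    (htot : ∑' k, p k = 1)
    (h0 : p 0 ≤ 2 / 3)
    (g : ℕ → ℝ) (hg : ∀ k, 0 ≤ g k) (hgtot : ∑' k, g k = 1)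
    (π : ℕ × ℕ × ℕ → ℕ) (hπ : Function.Bijective π) :
    (∑' x : ℕ × ℕ × ℕ, Real.sqrt (p (π x) * (p x.1 * p x.2.1 * g x.2.2)))
      ≤ Real.sqrt (1 - (2 / 9) ^ 2) := by
  have hp : Antitone p := antitone_nat_of_succ_le hmono
  have hp0 (k : ℕ) : 0 ≤ p k := (hnonneg k).trans (hmono k)
  have hp1 : HasSum p 1 := htot ▸ hsum.hasSum
  have hps (s : Finset ℕ) : ∑ i ∈ s, p i ≤ 1 := sum_le_hasSum s (fun i _ => hp0 i) hp1
  have hgs : Summable g := by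
    by_contra h
    simp [tsum_eq_zero_of_not_summable h] at hgtot
  have hg1 (s : Finset ℕ) : ∑ k ∈ s, g k ≤ 1 := hgtot ▸ hgs.sum_le_tsum s fun k _ => hg k
  have hr (x : ℕ × ℕ × ℕ) : 0 ≤ p x.1 * p x.2.1 * g x.2.2 :=
    mul_nonneg (mul_nonneg (hp0 _) (hp0 _)) (hg _)
  have hr_le := sum_triple_le_sum_image_mul_sum_image hp0 hp0 hg hg1
  obtain ⟨m, hm⟩ := exists_sum_range_mem_Icc hp hp1 h0
  let s : Finset (ℕ × ℕ × ℕ) := (Finset.range m).preimage π hπ.injective.injOn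
  have hs : s.image π = Finset.range m :=
    Finset.image_preimage_of_bij _ _ hπ.bijOn_preimage
  have hcard : s.card = m := by
    rw [← Finset.card_image_of_injective s hπ.injective, hs, Finset.card_range]
  have hqs : ∑ x ∈ s, p (π x) = ∑ i ∈ Finset.range m, p i := by
    rw [← hs, Finset.sum_image hπ.injective.injOn]
  have himage (f : ℕ × ℕ × ℕ → ℕ) :
      ∑ i ∈ s.image f, p i ≤ ∑ i ∈ Finset.range m, p i :=
    (hp.sum_le_sum_range_card _).trans <| Finset.sum_le_sum_of_subset_of_nonneg
      (Finset.range_mono (Finset.card_image_le.trans hcard.le)) fun i _ _ => hp0 i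
  have hrs : ∑ x ∈ s, p x.1 * p x.2.1 * g x.2.2 ≤ (∑ i ∈ Finset.range m, p i) ^ 2 := by
    rw [sq]
    exact (hr_le s).trans (mul_le_mul (himage _) (himage _) (Finset.sum_nonneg fun i _ => hp0 i)
      (Finset.sum_nonneg fun i _ => hp0 i))
  refine (tsum_sqrt_mul_le_sqrt_one_sub_sq (fun x => hp0 (π x)) hr (fun t => ?_) (fun t => ?_)
    s).trans (Real.sqrt_le_sqrt (sub_le_sub_left (pow_le_pow_left₀ (by norm_num) ?_ 2) 1))
  · rw [← Finset.sum_image (f := p) hπ.injective.injOn]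
    exact hps _
  · exact (hr_le t).trans (mul_le_one₀ (hps _) (Finset.sum_nonneg fun i _ => hp0 i) (hps _))
  · rw [hqs]
    nlinarith [mul_nonneg (sub_nonneg.2 hm.1) (sub_nonneg.2 hm.2)]
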